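/- Let A and B be n×n Hermitian matrices over ℂ. Then tr(AB) ≤ ∑_{j=1}^n λ_j↓(A) λ_j↓(B), where λ↓(M) denotes the list of eigenvalues of M, counted with multiplicity, arranged in nonincreasing order. -/

import Mathlib

/-- The squared moduli of the entries of a unitary matrix form a doubly stochastic matrix. -/
theorem map_normSq_mem_doublyStochastic {ι : Type*} [Fintype ι] [DecidableEq ι]
    {W : Matrix ι ι ℂ} (hW : W ∈ Matrix.unitaryGroup ι ℂ) :
    W.map Complex.normSq ∈ doublyStochastic ℝ ι := by
  refine mem_doublyStochastic_iff_sum.2 ⟨fun i j => Complex.normSq_nonneg _, fun i => ?_,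
    fun j => ?_⟩
  · have h := congrFun (congrFun (Matrix.mem_unitaryGroup_iff.1 hW) i) i
    simp only [Matrix.mul_apply, Matrix.star_apply, Matrix.one_apply_eq, Complex.star_def,
      Complex.mul_conj] at h
    exact_mod_cast h
  · have h := congrFun (congrFun (Matrix.mem_unitaryGroup_iff'.1 hW) j) j
    simp only [Matrix.mul_apply, Matrix.star_apply, Matrix.one_apply_eq, Complex.star_def,
      ← Complex.normSq_eq_conj_mul_self] at h
    exact_mod_cast h

/-- The rearrangement inequality for doubly stochastic matrices. -/
theorem Monovary.sum_mul_doublyStochastic_mul_le {ι : Type*} [Fintype ι] [DecidableEq ι]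
    {f g : ι → ℝ} (hfg : Monovary f g) {M : Matrix ι ι ℝ} (hM : M ∈ doublyStochastic ℝ ι) :
    ∑ i, ∑ j, f i * M i j * g j ≤ ∑ i, f i * g i := by
  obtain ⟨w, hw, hw1, rfl⟩ := exists_eq_sum_perm_of_mem_doublyStochastic hM
  calc
    _ = ∑ π : Equiv.Perm ι, w π * ∑ i, f i * g (π i) := by
      simp only [Matrix.sum_apply, Matrix.smul_apply, smul_eq_mul, Finset.mul_sum,
        Finset.sum_mul]
      conv_rhs => rw [Finset.sum_comm]
      refine Finset.sum_congr rfl fun i _ => ?_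
      rw [Finset.sum_comm]
      refine Finset.sum_congr rfl fun π _ => ?_
      simp [Equiv.toPEquiv_apply, PEquiv.toMatrix_apply]
      ring
    _ ≤ ∑ π : Equiv.Perm ι, w π * ∑ i, f i * g i :=
      Finset.sum_le_sum fun π _ =>
        mul_le_mul_of_nonneg_left hfg.sum_mul_comp_perm_le_sum_mul (hw π)
    _ = _ := by rw [← Finset.sum_mul, hw1, one_mul]

open Matrix in
/-- The trace of a product of two Hermitian matrices, in terms of their eigenvalues and the
overlaps of their eigenbases. -/
theorem Matrix.IsHermitian.re_trace_mul_eq_sum {ι : Type*} [Fintype ι] [DecidableEq ι]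
    {A B : Matrix ι ι ℂ} (hA : A.IsHermitian) (hB : B.IsHermitian) :
    ((A * B).trace).re = ∑ i, ∑ j, hA.eigenvalues i *
      Complex.normSq ((star hA.eigenvectorUnitary * hB.eigenvectorUnitary :
        Matrix.unitaryGroup ι ℂ) i j) * hB.eigenvalues j := by
  set W : Matrix ι ι ℂ := ↑(star hA.eigenvectorUnitary * hB.eigenvectorUnitary) with hW
  have h : (A * B).trace = (diagonal (RCLike.ofReal ∘ hA.eigenvalues) * W *
      diagonal (RCLike.ofReal ∘ hB.eigenvalues) * star W).trace := by
    conv_lhs => rw [hA.spectral_theorem, hB.spectral_theorem]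
    simp only [Unitary.conjStarAlgAut_apply, hW, Submonoid.coe_mul, Unitary.coe_star, star_mul,
      star_star, mul_assoc]
    rw [trace_mul_comm]
    simp only [mul_assoc]
  rw [h, trace, Complex.re_sum]
  refine Finset.sum_congr rfl fun i _ => ?_
  rw [diag_apply, mul_apply, Complex.re_sum]
  refine Finset.sum_congr rfl fun j _ => ?_
  rw [mul_diagonal, diagonal_mul, star_apply]
  simp [Complex.normSq_apply]
  ring

/-- Let `A` and `B` be `n × n` Hermitian matrices over `ℂ`.  If
`σ` and `τ` are permutations of the indices arranging the eigenvalues of `A` and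
of `B` (counted with multiplicity) into nonincreasing order `λ↓(A)`, `λ↓(B)`,
then `tr (A * B) ≤ ∑_j λ_j↓(A) * λ_j↓(B)` (the trace being real). -/
theorem trace_mul_le_eigenvalue_desc_desc_inner {n : ℕ}
    (A B : Matrix (Fin n) (Fin n) ℂ)
    (hA : A.IsHermitian) (hB : B.IsHermitian)
    (σ τ : Equiv.Perm (Fin n))
    (hσ : Antitone (hA.eigenvalues ∘ σ))
    (hτ : Antitone (hB.eigenvalues ∘ τ)) :
    ((A * B).trace).re
      ≤ ∑ j : Fin n, hA.eigenvalues (σ j) * hB.eigenvalues (τ j) := by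
  have hmono : Monovary (hA.eigenvalues ∘ σ) (hB.eigenvalues ∘ τ) := hσ.monovary hτ
  have hM := reindex_mem_doublyStochastic (e₁ := σ.symm) (e₂ := τ.symm)
    (map_normSq_mem_doublyStochastic
      (star hA.eigenvectorUnitary * hB.eigenvectorUnitary).2)
  rw [hA.re_trace_mul_eq_sum hB, ← Equiv.sum_comp σ,
    Finset.sum_congr rfl fun i _ => (Equiv.sum_comp τ _).symm]
  exact hmono.sum_mul_doublyStochastic_mul_le hM
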